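/- arXiv:2508.15726 — 7 statements merged into one kernel-verified Lean document; each statement's English description precedes it below -/
import Mathlib

section
/- Let V ⊆ ℤ² be a finite set of odd cardinality that is C_π-symmetric, i.e. there exists c ∈ ℤ² such that for all v ∈ ℤ², v ∈ V if and only if c − v ∈ V. Then the majority cellular automaton A_V is not an eroder: there exists a configuration s with finite nonempty damage such that for every t ∈ ℕ, A_V^t(s) is not the all-false configuration. -/
/-- A spin configuration on the 2D lattice. -/
abbrev Config := ℤ × ℤ → Bool

/-- The all-false configuration. -/
def allFalse : Config := fun _ => false

/-- The majority cellular automaton with voting neighborhood `V`: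
the new value at `r` is `true` iff strictly more than `|V|/2` of the
displacements `δ ∈ V` satisfy `s (r + δ) = true`. -/
def majCA (V : Finset (ℤ × ℤ)) (s : Config) : Config :=
  fun r => decide (V.card < 2 * (V.filter fun δ => s (r + δ) = true).card)

/-- `V` is C_π-symmetric: invariant under a π rotation about some point `c/2`. -/
def CpiSymmetric (V : Finset (ℤ × ℤ)) : Prop :=
  ∃ c : ℤ × ℤ, ∀ v : ℤ × ℤ, v ∈ V ↔ c - v ∈ V

/-- A finite set of odd cardinality invariant under `v ↦ c - v` contains a fixed point. -/
lemma exists_mem_add_self_eq_of_odd_card {V : Finset (ℤ × ℤ)} (hodd : Odd V.card) {c : ℤ × ℤ}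
    (hc : ∀ v, v ∈ V ↔ c - v ∈ V) : ∃ v ∈ V, v + v = c := by
  by_contra! h
  have hsum : ∑ _v ∈ V, (1 : ZMod 2) = 0 :=
    Finset.sum_involution (fun v _ => c - v) (fun _ _ => by decide)
      (fun v hv _ heq => h v hv (sub_eq_iff_eq_add.mp heq).symm)
      (fun v hv => (hc v).mp hv) (fun v _ => sub_sub_cancel c v)
  rw [Finset.sum_const, nsmul_eq_mul, mul_one, ZMod.natCast_eq_zero_iff_even] at hsum
  exact Nat.not_even_iff_odd.mpr hodd hsum

/-- The subset sums of the displacements `δ - v` with `δ ∈ V`. -/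
def subsetSums (V : Finset (ℤ × ℤ)) (v : ℤ × ℤ) : Finset (ℤ × ℤ) :=
  V.powerset.image fun T => ∑ δ ∈ T, (δ - v)

lemma mem_subsetSums_add_or_sub {V : Finset (ℤ × ℤ)} {v δ r : ℤ × ℤ} (hδ : δ ∈ V)
    (hr : r ∈ subsetSums V v) :
    r + (δ - v) ∈ subsetSums V v ∨ r - (δ - v) ∈ subsetSums V v := by
  simp only [subsetSums, Finset.mem_image, Finset.mem_powerset] at hr ⊢
  obtain ⟨T, hT, rfl⟩ := hr
  by_cases h : δ ∈ T
  · exact .inr ⟨T.erase δ, (T.erase_subset δ).trans hT, Finset.sum_erase_eq_sub h⟩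
  · exact .inl ⟨insert δ T, Finset.insert_subset hδ hT, by rw [Finset.sum_insert h, add_comm]⟩

lemma zero_mem_subsetSums (V : Finset (ℤ × ℤ)) (v : ℤ × ℤ) : 0 ∈ subsetSums V v :=
  Finset.mem_image.mpr ⟨∅, Finset.empty_mem_powerset V, Finset.sum_empty⟩

/-- If a subset `F` of `V` meets every pair `{δ, c - δ}` and contains a fixed point of
`δ ↦ c - δ`, then it is a strict majority of `V`. -/
lemma card_lt_two_mul_card_of_forall_mem_or {V F : Finset (ℤ × ℤ)} {c v : ℤ × ℤ}
    (hv : v ∈ F) (hvc : v + v = c) (h : ∀ δ ∈ V, δ ∈ F ∨ c - δ ∈ F) :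
    V.card < 2 * F.card := by
  have hsub : V ⊆ F ∪ F.image (c - ·) := fun δ hδ =>
    Finset.mem_union.mpr <| (h δ hδ).imp_right fun hF =>
      Finset.mem_image.mpr ⟨c - δ, hF, sub_sub_cancel c δ⟩
  have hinter : v ∈ F ∩ F.image (c - ·) :=
    Finset.mem_inter.mpr ⟨hv, Finset.mem_image.mpr ⟨v, hv, by simp [← hvc]⟩⟩
  have hpos := Finset.card_pos.mpr ⟨v, hinter⟩
  have hle := Finset.card_le_card hsub
  have hadd := Finset.card_union_add_card_inter F (F.image (c - ·))
  have himage : (F.image (c - ·)).card ≤ F.card := Finset.card_image_le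
  lia

/-- Damage containing a translate of the subset sums persists, moving by `-v` at each step. -/
lemma majCA_eq_true_of_subsetSums {V : Finset (ℤ × ℤ)} {c v : ℤ × ℤ} (hv : v ∈ V)
    (hvc : v + v = c) (hc : ∀ δ, δ ∈ V ↔ c - δ ∈ V) {s : Config} {x : ℤ × ℤ}
    (hs : ∀ r, r + x ∈ subsetSums V v → s r = true) {r : ℤ × ℤ}
    (hr : r + (x + v) ∈ subsetSums V v) : majCA V s r = true := by
  refine decide_eq_true (card_lt_two_mul_card_of_forall_mem_or (c := c) (v := v) ?_ hvc ?_)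
  · exact Finset.mem_filter.mpr ⟨hv, hs _ (by rwa [add_assoc, add_comm v x])⟩
  · intro δ hδ
    refine (mem_subsetSums_add_or_sub hδ hr).imp (fun h => ?_) (fun h => ?_)
    · refine Finset.mem_filter.mpr ⟨hδ, hs _ ?_⟩
      convert h using 1
      abel
    · refine Finset.mem_filter.mpr ⟨(hc δ).mp hδ, hs _ ?_⟩
      convert h using 1
      rw [← hvc]
      abel

theorem cpi_symmetric_majority_not_eroder
    (V : Finset (ℤ × ℤ)) (hodd : Odd V.card) (hsym : CpiSymmetric V) :
    ∃ s : Config, {r : ℤ × ℤ | s r = true}.Finite ∧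
      {r : ℤ × ℤ | s r = true}.Nonempty ∧
      ∀ t : ℕ, (majCA V)^[t] s ≠ allFalse := by
  obtain ⟨c, hc⟩ := hsym
  obtain ⟨v, hv, hvc⟩ := exists_mem_add_self_eq_of_odd_card hodd hc
  refine ⟨fun r => decide (r ∈ subsetSums V v), ?_, ⟨0, ?_⟩, fun t ht => ?_⟩
  · simp only [decide_eq_true_eq]
    exact (subsetSums V v).finite_toSet
  · exact decide_eq_true (zero_mem_subsetSums V v)
  · have key : ∀ (t : ℕ) (r : ℤ × ℤ), r + t • v ∈ subsetSums V v →
        (majCA V)^[t] (fun r => decide (r ∈ subsetSums V v)) r = true := by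
      intro t
      induction t with
      | zero => simp
      | succ t ih =>
        intro r hr
        rw [Function.iterate_succ_apply']
        exact majCA_eq_true_of_subsetSums hv hvc hc ih (by rwa [← succ_nsmul])
    have h := key t (-(t • v)) (by simpa using zero_mem_subsetSums V v)
    rw [ht] at h
    exact Bool.false_ne_true h
end

section
/- Let V ⊆ {−1,0,1}² ⊆ ℤ² be a set of odd cardinality that is not C_π-symmetric, i.e. there is no c ∈ ℤ² such that for all v ∈ ℤ², v ∈ V if and only if c − v ∈ V. Then the majority cellular automaton A_V is an eroder: for every configuration s with finite damage there exists t ∈ ℕ such that A_V^t(s) is the all-false configuration. -/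
/-- `A` is an eroder: every configuration with finite damage is mapped to the
all-false configuration after finitely many steps. -/
def IsEroder (A : Config → Config) : Prop :=
  ∀ s : Config, {r : ℤ × ℤ | s r = true}.Finite → ∃ t : ℕ, A^[t] s = allFalse

/-- More than half of `V` lies in the half-plane `c ≤ a.1 * x + a.2 * y`. -/
def MajorityInHalfPlane (V : Finset (ℤ × ℤ)) (a : ℤ × ℤ) (c : ℤ) : Prop :=
  V.card < 2 * (V.filter fun v => c ≤ a.1 * v.1 + a.2 * v.2).card

instance (V : Finset (ℤ × ℤ)) (a : ℤ × ℤ) (c : ℤ) : Decidable (MajorityInHalfPlane V a c) :=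
  inferInstanceAs (Decidable (_ < _))

/-- If the damage lies strictly below a line, one step of the automaton pushes that line back. -/
theorem MajorityInHalfPlane.majCA_lt {V : Finset (ℤ × ℤ)} {a : ℤ × ℤ} {c M : ℤ}
    (h : MajorityInHalfPlane V a c) {s : Config}
    (hs : ∀ r, s r = true → a.1 * r.1 + a.2 * r.2 < M) (r : ℤ × ℤ) (hr : majCA V s r = true) :
    a.1 * r.1 + a.2 * r.2 < M - c := by
  by_contra! hM
  have hr' : V.card < 2 * (V.filter fun δ => s (r + δ) = true).card := by simpa [majCA] using hr
  have hdisj : Disjoint (V.filter fun v => c ≤ a.1 * v.1 + a.2 * v.2)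
      (V.filter fun δ => s (r + δ) = true) := by
    refine Finset.disjoint_filter.2 fun v _ hv hsv => ?_
    have := hs _ hsv
    simp only [Prod.fst_add, Prod.snd_add, mul_add] at this
    linarith
  have hcard := Finset.card_le_card
    (Finset.union_subset (Finset.filter_subset (fun v => c ≤ a.1 * v.1 + a.2 * v.2) V)
      (Finset.filter_subset (fun δ => s (r + δ) = true) V))
  rw [Finset.card_union_of_disjoint hdisj] at hcard
  unfold MajorityInHalfPlane at h
  omega

theorem MajorityInHalfPlane.iterate_majCA_lt {V : Finset (ℤ × ℤ)} {a : ℤ × ℤ} {c M : ℤ}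
    (h : MajorityInHalfPlane V a c) {s : Config}
    (hs : ∀ r, s r = true → a.1 * r.1 + a.2 * r.2 < M) (t : ℕ) :
    ∀ r, (majCA V)^[t] s r = true → a.1 * r.1 + a.2 * r.2 < M - t * c := by
  induction t with
  | zero => simpa using hs
  | succ t ih =>
    intro r hr
    rw [Function.iterate_succ_apply'] at hr
    have := h.majCA_lt ih r hr
    push_cast
    linarith

theorem exists_forall_lt_of_finite_damage {s : Config} (hs : {r : ℤ × ℤ | s r = true}.Finite)
    (a : ℤ × ℤ) : ∃ M : ℤ, ∀ r, s r = true → a.1 * r.1 + a.2 * r.2 < M := by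
  obtain ⟨M, hM⟩ := (hs.image fun r : ℤ × ℤ => a.1 * r.1 + a.2 * r.2).bddAbove
  exact ⟨M + 1, fun r hr => Int.lt_add_one_of_le (hM ⟨r, hr, rfl⟩)⟩

/-- Toom's criterion for three half-planes with empty intersection. -/
theorem isEroder_majCA_of_majorityInHalfPlane {V : Finset (ℤ × ℤ)} {a₁ a₂ a₃ : ℤ × ℤ}
    {c₁ c₂ c₃ : ℤ} (h₁ : MajorityInHalfPlane V a₁ c₁) (h₂ : MajorityInHalfPlane V a₂ c₂)
    (h₃ : MajorityInHalfPlane V a₃ c₃) (ha : a₁ + a₂ + a₃ = 0) (hc : 0 < c₁ + c₂ + c₃) :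
    IsEroder (majCA V) := by
  intro s hs
  obtain ⟨M₁, hM₁⟩ := exists_forall_lt_of_finite_damage hs a₁
  obtain ⟨M₂, hM₂⟩ := exists_forall_lt_of_finite_damage hs a₂
  obtain ⟨M₃, hM₃⟩ := exists_forall_lt_of_finite_damage hs a₃
  refine ⟨(M₁ + M₂ + M₃).toNat, funext fun r => Bool.eq_false_iff.2 fun hr => ?_⟩
  have e₁ := h₁.iterate_majCA_lt hM₁ _ r hr
  have e₂ := h₂.iterate_majCA_lt hM₂ _ r hr
  have e₃ := h₃.iterate_majCA_lt hM₃ _ r hr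
  have hx : a₁.1 + a₂.1 + a₃.1 = 0 := congrArg Prod.fst ha
  have hy : a₁.2 + a₂.2 + a₃.2 = 0 := congrArg Prod.snd ha
  have hsum : (a₁.1 * r.1 + a₁.2 * r.2) + (a₂.1 * r.1 + a₂.2 * r.2) + (a₃.1 * r.1 + a₃.2 * r.2)
      = 0 := by
    linear_combination r.1 * hx + r.2 * hy
  have hM := Int.self_le_toNat (M₁ + M₂ + M₃)
  nlinarith [Int.natCast_nonneg (M₁ + M₂ + M₃).toNat]

theorem cpiSymmetric_of_forall_mem {V : Finset (ℤ × ℤ)} {c : ℤ × ℤ} (h : ∀ v ∈ V, c - v ∈ V) :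
    CpiSymmetric V :=
  ⟨c, fun v => ⟨h v, fun hv => by simpa using h _ hv⟩⟩

/-- A set of odd cardinality in the `3 × 3` square with coordinatewise median `p` either is symmetric
about `p`, or has a median in some direction `u` that differs from the value of `u` at `p`. -/
theorem symmetric_or_exists_majorityInHalfPlane :
    ∀ V ∈ (({-1, 0, 1} : Finset ℤ) ×ˢ ({-1, 0, 1} : Finset ℤ)).powerset, V.card % 2 = 1 →
      ∃ p ∈ ({-1, 0, 1} : Finset ℤ) ×ˢ ({-1, 0, 1} : Finset ℤ),
        MajorityInHalfPlane V (1, 0) p.1 ∧ MajorityInHalfPlane V (-1, 0) (-p.1) ∧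
        MajorityInHalfPlane V (0, 1) p.2 ∧ MajorityInHalfPlane V (0, -1) (-p.2) ∧
        ((∀ v ∈ V, p + p - v ∈ V) ∨
          ∃ u ∈ ({-3, -1, 1, 3} : Finset ℤ) ×ˢ ({-3, -1, 1, 3} : Finset ℤ),
            MajorityInHalfPlane V u (u.1 * p.1 + u.2 * p.2 + 1) ∧
            MajorityInHalfPlane V (-u.1, 0) (-u.1 * p.1) ∧
            MajorityInHalfPlane V (0, -u.2) (-u.2 * p.2)) := by
  decide +kernel

theorem asymmetric_majority_is_eroder
    (V : Finset (ℤ × ℤ)) (hV : ∀ v ∈ V, |v.1| ≤ 1 ∧ |v.2| ≤ 1)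
    (hodd : Odd V.card) (hnsym : ¬ CpiSymmetric V) :
    IsEroder (majCA V) := by
  have hmem : V ∈ (({-1, 0, 1} : Finset ℤ) ×ˢ ({-1, 0, 1} : Finset ℤ)).powerset := by
    refine Finset.mem_powerset.2 fun v hv => ?_
    have h := hV v hv
    simp only [abs_le] at h
    simp only [Finset.mem_product, Finset.mem_insert, Finset.mem_singleton]
    omega
  obtain ⟨p, -, -, -, -, -, hp | ⟨u, -, h₁, h₂, h₃⟩⟩ :=
    symmetric_or_exists_majorityInHalfPlane V hmem (Nat.odd_iff.1 hodd)
  · exact absurd (cpiSymmetric_of_forall_mem hp) hnsym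
  · refine isEroder_majCA_of_majorityInHalfPlane h₁ h₂ h₃ ?_ ?_
    · ext <;> simp
    · linarith
end

section
/- Let V ⊆ {−1,0,1}² ⊆ ℤ² be a set of odd cardinality that is not C_π-symmetric. Then the majority cellular automaton A_V erodes damage in time linear in its diameter: there exists a constant C > 0 such that for every R ≥ 1 and every configuration s whose damage is contained in the square [−R,R]², A_V^t(s) is the all-false configuration for every t ≥ C·R. -/
/-- The standard bilinear pairing on `ℤ²`. -/
def latticeDot (a r : ℤ × ℤ) : ℤ := a.1 * r.1 + a.2 * r.2

lemma latticeDot_add_left (a b r : ℤ × ℤ) :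
    latticeDot (a + b) r = latticeDot a r + latticeDot b r := by
  simp only [latticeDot, Prod.fst_add, Prod.snd_add]; ring

lemma latticeDot_add_right (a r δ : ℤ × ℤ) :
    latticeDot a (r + δ) = latticeDot a r + latticeDot a δ := by
  simp only [latticeDot, Prod.fst_add, Prod.snd_add]; ring

lemma latticeDot_neg_left (a r : ℤ × ℤ) : latticeDot (-a) r = -latticeDot a r := by
  simp only [latticeDot, Prod.fst_neg, Prod.snd_neg]; ring

/-- A strict majority of `V` lies in the half-plane `{δ | k ≤ a · δ}`. -/
def MajorityAbove (V : Finset (ℤ × ℤ)) (a : ℤ × ℤ) (k : ℤ) : Prop :=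
  V.card < 2 * (V.filter fun δ => k ≤ latticeDot a δ).card

/-- Two strict majorities of a finite set intersect. -/
lemma exists_mem_of_two_majorities {α : Type*} (V : Finset α) (p q : α → Prop)
    [DecidablePred p] [DecidablePred q] (hp : V.card < 2 * (V.filter p).card)
    (hq : V.card < 2 * (V.filter q).card) : ∃ δ ∈ V, p δ ∧ q δ := by
  by_contra! h
  have hle : (V.filter q).card ≤ (V.filter fun δ => ¬ p δ).card :=
    Finset.card_le_card fun δ hδ => by
      simp only [Finset.mem_filter] at hδ ⊢
      exact ⟨hδ.1, fun hpδ => h δ hδ.1 hpδ hδ.2⟩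
  have := V.card_filter_add_card_filter_not p
  omega

/-- Every integer-valued function on a finite set of odd cardinality has a median. -/
lemma exists_median {α : Type*} (V : Finset α) (hodd : Odd V.card) (f : α → ℤ) :
    ∃ k : ℤ, V.card < 2 * (V.filter fun δ => k ≤ f δ).card ∧
      V.card < 2 * (V.filter fun δ => f δ ≤ k).card := by
  obtain ⟨B, hB⟩ : ∃ B : ℤ, ∀ δ ∈ V, |f δ| ≤ B :=
    ⟨∑ δ ∈ V, |f δ|, fun δ hδ =>
      Finset.single_le_sum (f := fun δ => |f δ|) (fun _ _ => abs_nonneg _) hδ⟩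
  obtain ⟨k, hk, hmax⟩ := Int.exists_greatest_of_bdd
    (P := fun k => V.card < 2 * (V.filter fun δ => k ≤ f δ).card)
    ⟨B, fun k hk => by
      obtain ⟨δ, hδ⟩ : (V.filter fun δ => k ≤ f δ).Nonempty := by
        rw [← Finset.card_pos]; omega
      rw [Finset.mem_filter] at hδ
      exact hδ.2.trans ((le_abs_self _).trans (hB δ hδ.1))⟩
    ⟨-B, by
      rw [Finset.filter_true_of_mem fun δ hδ => neg_le_of_abs_le (hB δ hδ)]
      have := hodd.pos
      omega⟩
  refine ⟨k, hk, ?_⟩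
  have hnot : ¬ V.card < 2 * (V.filter fun δ => k + 1 ≤ f δ).card := fun h => by
    have := hmax _ h
    omega
  have hsplit := V.card_filter_add_card_filter_not fun δ => f δ ≤ k
  have hcompl : (V.filter fun δ => ¬ f δ ≤ k) = V.filter fun δ => k + 1 ≤ f δ :=
    Finset.filter_congr fun δ _ => by omega
  rw [hcompl] at hsplit
  obtain ⟨j, hj⟩ := hodd
  omega

/-- If a majority of `V` lies in `{δ | k ≤ a · δ}`, then any upper bound for `a` on the damage
moves by at least `-k` at each step. -/
lemma latticeDot_le_of_iterate {V : Finset (ℤ × ℤ)} {a : ℤ × ℤ} {k M : ℤ}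
    (h : MajorityAbove V a k) {s : Config} (hs : ∀ r, s r = true → latticeDot a r ≤ M)
    (t : ℕ) (r : ℤ × ℤ) (hr : (majCA V)^[t] s r = true) : latticeDot a r ≤ M - t * k := by
  induction t generalizing r with
  | zero => simpa using hs r hr
  | succ t ih =>
    rw [Function.iterate_succ_apply', majCA, decide_eq_true_eq] at hr
    obtain ⟨δ, -, hδ, hk⟩ := exists_mem_of_two_majorities V _ _ hr h
    have := ih _ hδ
    rw [latticeDot_add_right] at this
    push_cast
    linarith

/-- Three majority half-planes with empty intersection, certified by normals summing to zero and
offsets with positive sum, make the majority automaton erode damage in linear time. -/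
lemma erodes_linearly_of_majorityAbove {V : Finset (ℤ × ℤ)} {a b c : ℤ × ℤ} {i j k : ℤ}
    (ha : MajorityAbove V a i) (hb : MajorityAbove V b j) (hc : MajorityAbove V c k)
    (hzero : a + b + c = 0) (hpos : 0 < i + j + k) :
    ∃ C : ℝ, 0 < C ∧ ∀ R : ℕ, 1 ≤ R → ∀ s : Config,
      (∀ r : ℤ × ℤ, s r = true → |r.1| ≤ (R : ℤ) ∧ |r.2| ≤ (R : ℤ)) →
      ∀ t : ℕ, C * (R : ℝ) ≤ (t : ℝ) → (majCA V)^[t] s = allFalse := by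
  let ν : ℤ × ℤ → ℤ := fun a => |a.1| + |a.2|
  have hν (a) : 0 ≤ ν a := by positivity
  refine ⟨((ν a + ν b + ν c + 1 : ℤ) : ℝ), ?_, fun R hR s hs t ht => ?_⟩
  · have := hν a; have := hν b; have := hν c
    exact_mod_cast (by linarith : (0 : ℤ) < ν a + ν b + ν c + 1)
  have ht' : (ν a + ν b + ν c + 1) * (R : ℤ) ≤ t := by exact_mod_cast ht
  have hbound (a r : ℤ × ℤ) (hr : s r = true) : latticeDot a r ≤ ν a * R := by
    obtain ⟨h₁, h₂⟩ := hs r hr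
    calc latticeDot a r ≤ |a.1| * |r.1| + |a.2| * |r.2| := by
          rw [← abs_mul, ← abs_mul]
          exact add_le_add (le_abs_self _) (le_abs_self _)
      _ ≤ |a.1| * R + |a.2| * R := by gcongr
      _ = ν a * R := by ring
  funext r
  by_contra hne
  have hr : (majCA V)^[t] s r = true := by simpa [allFalse] using hne
  have h₁ := latticeDot_le_of_iterate ha (hbound a) t r hr
  have h₂ := latticeDot_le_of_iterate hb (hbound b) t r hr
  have h₃ := latticeDot_le_of_iterate hc (hbound c) t r hr
  have hsum : latticeDot a r + latticeDot b r + latticeDot c r = 0 := by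
    rw [← latticeDot_add_left, ← latticeDot_add_left, hzero]; simp [latticeDot]
  have hR' : (1 : ℤ) ≤ R := by exact_mod_cast hR
  have htk : (t : ℤ) ≤ t * (i + j + k) := le_mul_of_one_le_right (by positivity) hpos
  linarith

/-- If all lines through `c` bisect the subset `V` of the `3 × 3` box, then `V` is symmetric
about `c`. -/
lemma cpiSymmetric_of_bisecting {V : Finset (ℤ × ℤ)} (hV : ∀ v ∈ V, |v.1| ≤ 1 ∧ |v.2| ≤ 1)
    {c : ℤ × ℤ} (hc : |c.1| ≤ 1 ∧ |c.2| ≤ 1)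
    (hbis : ∀ a : ℤ × ℤ, 2 * (V.filter fun δ => 0 < latticeDot a (δ - c)).card < V.card) :
    CpiSymmetric V := by
  have key : ∀ v ∈ V, (c + c) - v ∈ V := by
    intro v hv
    by_cases hvc : v = c
    · rwa [hvc, add_sub_cancel_right, ← hvc]
    let u : ℤ × ℤ := v - c
    let n : ℤ × ℤ := (-u.2, u.1)
    have hc₁ := abs_le.1 hc.1
    have hc₂ := abs_le.1 hc.2
    have hbox (δ) (hδ : δ ∈ V) : |latticeDot u (δ - c)| ≤ 8 := by
      have hδ₁ := abs_le.1 (hV δ hδ).1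
      have hδ₂ := abs_le.1 (hV δ hδ).2
      have hv₁ := abs_le.1 (hV v hv).1
      have hv₂ := abs_le.1 (hV v hv).2
      have h₁ : |u.1 * (δ - c).1| ≤ 2 * 2 := by
        rw [abs_mul]
        gcongr <;> rw [abs_le] <;> simp only [u, Prod.fst_sub] <;> omega
      have h₂ : |u.2 * (δ - c).2| ≤ 2 * 2 := by
        rw [abs_mul]
        gcongr <;> rw [abs_le] <;> simp only [u, Prod.snd_sub] <;> omega
      exact (abs_add_le _ _).trans (by linarith)
    have hdot (x y : ℤ) (δ : ℤ × ℤ) : latticeDot (x * n.1 + y * u.1, x * n.2 + y * u.2) δ =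
        x * latticeDot n δ + y * latticeDot u δ := by
      simp only [latticeDot]; ring
    -- The line through `c` along `u` cuts `V` into two sides, two rays, and possibly `c`.
    let L := V.filter fun δ => 0 < latticeDot n (δ - c)
    let L' := V.filter fun δ => latticeDot n (δ - c) < 0
    let r := V.filter fun δ => latticeDot n (δ - c) = 0 ∧ 0 < latticeDot u (δ - c)
    let r' := V.filter fun δ => latticeDot n (δ - c) = 0 ∧ latticeDot u (δ - c) < 0
    have hLr : L.card + r.card ≤
        (V.filter fun δ => 0 < latticeDot (9 * n.1 + 1 * u.1, 9 * n.2 + 1 * u.2) (δ - c)).card := by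
      rw [← Finset.card_union_of_disjoint (Finset.disjoint_filter.2 fun δ _ => by omega)]
      refine Finset.card_le_card fun δ hδ => ?_
      simp only [Finset.mem_union, Finset.mem_filter, hdot] at hδ ⊢
      have hδV : δ ∈ V := by tauto
      have := abs_le.1 (hbox δ hδV)
      exact ⟨hδV, by omega⟩
    have hLr' : L'.card + r.card ≤
        (V.filter fun δ => 0 < latticeDot (-9 * n.1 + 1 * u.1, -9 * n.2 + 1 * u.2) (δ - c)).card := by
      rw [← Finset.card_union_of_disjoint (Finset.disjoint_filter.2 fun δ _ => by omega)]
      refine Finset.card_le_card fun δ hδ => ?_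
      simp only [Finset.mem_union, Finset.mem_filter, hdot] at hδ ⊢
      have hδV : δ ∈ V := by tauto
      have := abs_le.1 (hbox δ hδV)
      exact ⟨hδV, by omega⟩
    have hu0 : 0 < u.1 * u.1 + u.2 * u.2 := by
      have hne : u.1 ≠ 0 ∨ u.2 ≠ 0 := by
        by_contra! h
        exact hvc (sub_eq_zero.1 (Prod.ext h.1 h.2))
      rcases hne with h | h
      · have := mul_self_pos.2 h; have := mul_self_nonneg u.2; linarith
      · have := mul_self_pos.2 h; have := mul_self_nonneg u.1; linarith
    have hcover : V ⊆ insert c ((L ∪ L') ∪ (r ∪ r')) := by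
      intro δ hδ
      simp only [L, L', r, r', Finset.mem_insert, Finset.mem_union, Finset.mem_filter, hδ,
        true_and]
      by_contra! h
      obtain ⟨hne, ⟨h₁, h₂⟩, h₃, h₄⟩ := h
      have hn : latticeDot n (δ - c) = 0 := by omega
      have hd : latticeDot u (δ - c) = 0 := le_antisymm (h₃ hn) (h₄ hn)
      simp only [latticeDot, n] at hn hd
      apply hne
      refine sub_eq_zero.1 (Prod.ext ?_ ?_)
      · refine (mul_eq_zero.1 (?_ : (u.1 * u.1 + u.2 * u.2) * (δ - c).1 = 0)).resolve_left hu0.ne'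
        linear_combination u.1 * hd - u.2 * hn
      · refine (mul_eq_zero.1 (?_ : (u.1 * u.1 + u.2 * u.2) * (δ - c).2 = 0)).resolve_left hu0.ne'
        linear_combination u.2 * hd + u.1 * hn
    have hcard : V.card ≤ L.card + L'.card + (r.card + r'.card) + 1 :=
      (Finset.card_le_card hcover).trans <| (Finset.card_insert_le _ _).trans <|
        Nat.add_le_add_right ((Finset.card_union_le _ _).trans
          (Nat.add_le_add (Finset.card_union_le _ _) (Finset.card_union_le _ _))) 1
    have hvr : 0 < r.card :=
      Finset.card_pos.2 ⟨v, Finset.mem_filter.2 ⟨hv, by simp only [latticeDot, n, u]; ring, hu0⟩⟩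
    have hb := hbis (9 * n.1 + 1 * u.1, 9 * n.2 + 1 * u.2)
    have hb' := hbis (-9 * n.1 + 1 * u.1, -9 * n.2 + 1 * u.2)
    obtain ⟨w, hw⟩ : r'.Nonempty := by
      rw [← Finset.card_pos]
      omega
    obtain ⟨hwV, hw0, hwneg⟩ := Finset.mem_filter.1 hw
    suffices (c + c) - v = w by rwa [this]
    have hreflect (p q d p' : ℤ) (hp : |p| ≤ 1) (hq : |q| ≤ 1) (hd : d < 0)
        (h : (u.1 * u.1 + u.2 * u.2) * (q - p') = (p - p') * d) : p' + p' - p = q := by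
      rw [abs_le] at hp hq
      rcases lt_trichotomy p p' with hlt | heq | hgt
      · have := pos_of_mul_pos_right (h ▸ mul_pos_of_neg_of_neg (sub_neg.2 hlt) hd) hu0.le
        omega
      · have := (mul_eq_zero.1 (h.trans (by rw [heq, sub_self, zero_mul]))).resolve_left hu0.ne'
        omega
      · have := neg_of_mul_neg_right (h ▸ mul_neg_of_pos_of_neg (sub_pos.2 hgt) hd) hu0.le
        omega
    simp only [latticeDot, n] at hw0
    refine Prod.ext (hreflect v.1 w.1 _ c.1 (hV v hv).1 (hV w hwV).1 hwneg ?_)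
      (hreflect v.2 w.2 _ c.2 (hV v hv).2 (hV w hwV).2 hwneg ?_)
    · change _ * (w - c).1 = u.1 * _
      rw [latticeDot]
      linear_combination -u.2 * hw0
    · change _ * (w - c).2 = u.2 * _
      rw [latticeDot]
      linear_combination u.1 * hw0
  refine ⟨c + c, fun v => ⟨key v, fun hv => ?_⟩⟩
  simpa using key _ hv

theorem asymmetric_majority_erodes_linearly
    (V : Finset (ℤ × ℤ)) (hV : ∀ v ∈ V, |v.1| ≤ 1 ∧ |v.2| ≤ 1)
    (hodd : Odd V.card) (hnsym : ¬ CpiSymmetric V) :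
    ∃ C : ℝ, 0 < C ∧ ∀ R : ℕ, 1 ≤ R → ∀ s : Config,
      (∀ r : ℤ × ℤ, s r = true → |r.1| ≤ (R : ℤ) ∧ |r.2| ≤ (R : ℤ)) →
      ∀ t : ℕ, C * (R : ℝ) ≤ (t : ℝ) → (majCA V)^[t] s = allFalse := by
  choose m hm hm' using fun a => exists_median V hodd (latticeDot a)
  have habove (a) : MajorityAbove V a (m a) := hm a
  have hbelow (a) : MajorityAbove V (-a) (-m a) := by
    simpa [MajorityAbove, latticeDot_neg_left] using hm' a
  by_cases hadd : ∀ a b, m (a + b) = m a + m b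
  · -- An additive median is evaluation at a centre of symmetry.
    refine absurd ?_ hnsym
    have hlin (a) : m a = latticeDot a (m (1, 0), m (0, 1)) := by
      let f : ℤ × ℤ →+ ℤ := AddMonoidHom.mk' m hadd
      have ha : a = a.1 • ((1, 0) : ℤ × ℤ) + a.2 • ((0, 1) : ℤ × ℤ) := by ext <;> simp
      calc m a = f (a.1 • ((1, 0) : ℤ × ℤ) + a.2 • ((0, 1) : ℤ × ℤ)) := by rw [← ha]; rfl
        _ = latticeDot a (m (1, 0), m (0, 1)) := by
          rw [map_add, map_zsmul, map_zsmul]; rfl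
    have hmem (a) : ∃ δ ∈ V, latticeDot a δ = m a := by
      obtain ⟨δ, hδ, h₁, h₂⟩ := exists_mem_of_two_majorities V _ _ (hm a) (hm' a)
      exact ⟨δ, hδ, le_antisymm h₂ h₁⟩
    refine cpiSymmetric_of_bisecting hV (c := (m (1, 0), m (0, 1))) ⟨?_, ?_⟩ fun a => ?_
    · obtain ⟨δ, hδ, h⟩ := hmem (1, 0)
      simpa [← h, latticeDot] using (hV δ hδ).1
    · obtain ⟨δ, hδ, h⟩ := hmem (0, 1)
      simpa [← h, latticeDot] using (hV δ hδ).2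
    · have hsplit := V.card_filter_add_card_filter_not fun δ => latticeDot a δ ≤ m a
      have hcompl : (V.filter fun δ => ¬ latticeDot a δ ≤ m a) =
          V.filter fun δ => 0 < latticeDot a (δ - (m (1, 0), m (0, 1))) :=
        Finset.filter_congr fun δ _ => by
          rw [hlin a, not_le, ← sub_pos]
          simp only [latticeDot, Prod.fst_sub, Prod.snd_sub]
          ring_nf
      rw [hcompl] at hsplit
      have := hm' a
      omega
  · push Not at hadd
    obtain ⟨a, b, hab⟩ := hadd
    rcases lt_or_gt_of_ne hab with h | h
    · exact erodes_linearly_of_majorityAbove (habove a) (habove b) (hbelow (a + b))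
        (by abel) (by linarith)
    · exact erodes_linearly_of_majorityAbove (hbelow a) (hbelow b) (habove (a + b))
        (by abel) (by linarith)
end

section
/- Let V ⊆ {−1,0,1}² ⊆ ℤ² have odd cardinality, and suppose that every γ_x^σ and every γ_y^σ half-plane configuration (for both σ ∈ {+1,−1} and all offsets c ∈ ℤ, and for both orientations of each wall) is a fixed point of the majority cellular automaton A_V, i.e. A_V(H) = H for all such H. Then V is invariant under the π rotation about the origin: for all v ∈ ℤ², v ∈ V if and only if −v ∈ V. -/
/-- A `γ_x^σ` half-plane configuration: a half plane bounded by a line of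
slope `σ/2`, in either orientation. -/
def IsGammaX (σ : ℤ) (H : Config) : Prop :=
  ∃ c : ℤ, (∀ r : ℤ × ℤ, H r = decide (c ≤ 2 * r.2 - σ * r.1)) ∨
           (∀ r : ℤ × ℤ, H r = !decide (c ≤ 2 * r.2 - σ * r.1))

/-- A `γ_y^σ` half-plane configuration: a half plane bounded by a line of
slope `2σ`, in either orientation. -/
def IsGammaY (σ : ℤ) (H : Config) : Prop :=
  ∃ c : ℤ, (∀ r : ℤ × ℤ, H r = decide (c ≤ 2 * r.1 - σ * r.2)) ∨
           (∀ r : ℤ × ℤ, H r = !decide (c ≤ 2 * r.1 - σ * r.2))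

/-- Counting the elements of a subset of `{-1, 0, 1}²` as a sum of nine indicators. -/
theorem card_filter_eq_sum_box (V : Finset (ℤ × ℤ)) (hV : ∀ v ∈ V, |v.1| ≤ 1 ∧ |v.2| ≤ 1)
    (p : ℤ × ℤ → Prop) [DecidablePred p] :
    (V.filter p).card =
      ∑ x ∈ ({-1, 0, 1} : Finset ℤ), ∑ y ∈ ({-1, 0, 1} : Finset ℤ),
        if p (x, y) then (if (x, y) ∈ V then 1 else 0) else 0 := by
  rw [← Finset.sum_product', Finset.card_eq_sum_ones, ← Finset.sum_filter, ← Finset.sum_filter]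
  refine Finset.sum_congr (Finset.ext fun v => ?_) fun _ _ => rfl
  have h : v ∈ V → (v.1 = -1 ∨ v.1 = 0 ∨ v.1 = 1) ∧ (v.2 = -1 ∨ v.2 = 0 ∨ v.2 = 1) := by
    intro hv
    obtain ⟨h1, h2⟩ := hV v hv
    rw [abs_le] at h1 h2
    omega
  simp only [Finset.mem_filter, Finset.mem_product, Finset.mem_insert, Finset.mem_singleton,
    Prod.mk.eta]
  tauto

/-- If the half planes `0 ≤ L` and `1 ≤ L` are fixed, then `0` is the median of `L` on `V`. -/
theorem median_of_fixed_half_planes (V : Finset (ℤ × ℤ)) (L : ℤ × ℤ → ℤ) (hL : L 0 = 0)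
    (h : ∀ c : ℤ, majCA V (fun r => decide (c ≤ L r)) = fun r => decide (c ≤ L r)) :
    V.card < 2 * (V.filter fun δ => 0 ≤ L δ).card ∧
      2 * (V.filter fun δ => 1 ≤ L δ).card ≤ V.card := by
  have h0 := congrFun (h 0) 0
  have h1 := congrFun (h 1) 0
  simp only [majCA, zero_add, decide_eq_true_eq, hL, decide_eq_decide] at h0 h1
  exact ⟨h0.2 le_rfl, not_lt.1 fun hlt => absurd (h1.1 hlt) (by norm_num)⟩

theorem all_walls_fixed_implies_symmetric
    (V : Finset (ℤ × ℤ)) (hV : ∀ v ∈ V, |v.1| ≤ 1 ∧ |v.2| ≤ 1)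
    (hodd : Odd V.card)
    (hx : ∀ σ : ℤ, (σ = 1 ∨ σ = -1) →
      ∀ H : Config, IsGammaX σ H → majCA V H = H)
    (hy : ∀ σ : ℤ, (σ = 1 ∨ σ = -1) →
      ∀ H : Config, IsGammaY σ H → majCA V H = H) :
    ∀ v : ℤ × ℤ, v ∈ V ↔ -v ∈ V := by
  have hX (σ : ℤ) (hσ : σ = 1 ∨ σ = -1) :=
    median_of_fixed_half_planes V (fun r => 2 * r.2 - σ * r.1) (by simp)
      fun c => hx σ hσ _ ⟨c, Or.inl fun _ => rfl⟩
  have hY (σ : ℤ) (hσ : σ = 1 ∨ σ = -1) :=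
    median_of_fixed_half_planes V (fun r => 2 * r.1 - σ * r.2) (by simp)
      fun c => hy σ hσ _ ⟨c, Or.inl fun _ => rfl⟩
  have hX1 := hX 1 (Or.inl rfl)
  have hX2 := hX (-1) (Or.inr rfl)
  have hY1 := hY 1 (Or.inl rfl)
  have hY2 := hY (-1) (Or.inr rfl)
  have hcard := card_filter_eq_sum_box V hV fun _ => True
  simp only [card_filter_eq_sum_box V hV] at hX1 hX2 hY1 hY2
  simp [-Finset.sum_boole] at hX1 hX2 hY1 hY2 hcard
  have hle (v : ℤ × ℤ) : (if v ∈ V then 1 else 0) ≤ 1 := by split_ifs <;> omega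
  have key : ∀ v ∈ V, -v ∈ V := by
    intro v hv
    obtain ⟨h1, h2⟩ := hV v hv
    rw [abs_le] at h1 h2
    obtain ⟨x, y⟩ := v
    obtain ⟨m, hm⟩ := hodd
    have h1' : x = -1 ∨ x = 0 ∨ x = 1 := by dsimp at h1; omega
    have h2' : y = -1 ∨ y = 0 ∨ y = 1 := by dsimp at h2; omega
    have h00 := hle (0, 0)
    by_contra hn
    rcases h1' with rfl | rfl | rfl <;> rcases h2' with rfl | rfl | rfl <;>
      simp only [Prod.neg_mk, neg_neg, neg_zero] at hn <;>
      first
      | exact hn hv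
      | (simp only [if_pos hv, if_neg hn] at hX1 hX2 hY1 hY2 hcard
         omega)
  exact fun v => ⟨key v, fun h => neg_neg v ▸ key _ h⟩
end

section
/- Let V ⊆ ℤ² be a finite set of odd cardinality with V = −V (invariance under the π rotation about the origin). Let n ∈ ℤ² be nonzero, c ∈ ℤ, and let H be the half-plane configuration with H(r) = (n·r ≥ c) (with n·r the standard dot product). If A_V(H) = T_d(H) for some d ∈ ℤ², then A_V(H) = H: domain walls of uniform slope cannot move under a C_π-symmetric majority rule. -/
/-- The translate of a configuration by `d`. -/
def translateBy (d : ℤ × ℤ) (s : Config) : Config := fun r => s (r - d)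

/-- If negation maps the part of a symmetric finite set satisfying `p` into the part satisfying
`q`, then the former is at most as large as the latter. -/
theorem card_filter_le_card_filter_of_neg {G : Type*} [InvolutiveNeg G] (V : Finset G)
    (hsym : ∀ v : G, v ∈ V ↔ -v ∈ V) (p q : G → Prop) [DecidablePred p] [DecidablePred q]
    (hpq : ∀ v, p v → q (-v)) :
    (V.filter p).card ≤ (V.filter q).card := by
  refine Finset.card_le_card_of_injOn (fun v => -v) (fun v hv => ?_) neg_injective.injOn
  have hv' := Finset.mem_filter.mp hv
  exact Finset.mem_filter.mpr ⟨(hsym v).mp hv'.1, hpq v hv'.2⟩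

/-- A symmetric majority rule of odd size fixes every half-plane configuration. -/
theorem majCA_halfPlane (V : Finset (ℤ × ℤ)) (hodd : Odd V.card)
    (hsym : ∀ v : ℤ × ℤ, v ∈ V ↔ -v ∈ V) (n : ℤ × ℤ) (c : ℤ) (H : Config)
    (hH : ∀ r : ℤ × ℤ, H r = decide (c ≤ n.1 * r.1 + n.2 * r.2)) :
    majCA V H = H := by
  funext r
  have hsum := Finset.card_filter_add_card_filter_not (s := V) (fun δ => H (r + δ) = true)
  obtain ⟨k, hk⟩ := hodd
  rw [majCA, hH r, decide_eq_decide]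
  by_cases hr : c ≤ n.1 * r.1 + n.2 * r.2
  · have hle := card_filter_le_card_filter_of_neg V hsym (fun δ => ¬ H (r + δ) = true)
      (fun δ => H (r + δ) = true) (fun v hv => by
        simp only [hH, decide_eq_true_eq, Prod.fst_add, Prod.snd_add, Prod.fst_neg, Prod.snd_neg,
          mul_add, mul_neg] at hv ⊢
        linarith)
    exact iff_of_true (by omega) hr
  · have hle := card_filter_le_card_filter_of_neg V hsym (fun δ => H (r + δ) = true)
      (fun δ => ¬ H (r + δ) = true) (fun v hv => by
        simp only [hH, decide_eq_true_eq, Prod.fst_add, Prod.snd_add, Prod.fst_neg, Prod.snd_neg,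
          mul_add, mul_neg] at hv ⊢
        linarith)
    exact iff_of_false (by omega) hr

theorem symmetric_rule_walls_cannot_move
    (V : Finset (ℤ × ℤ)) (hodd : Odd V.card)
    (hsym : ∀ v : ℤ × ℤ, v ∈ V ↔ -v ∈ V)
    (n : ℤ × ℤ) (hn : n ≠ 0) (c : ℤ) (H : Config)
    (hH : ∀ r : ℤ × ℤ, H r = decide (c ≤ n.1 * r.1 + n.2 * r.2))
    (d : ℤ × ℤ) (hd : majCA V H = translateBy d H) :
    majCA V H = H := by
  exact majCA_halfPlane V hodd hsym n c H hH
end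

section
/- Let V ⊆ ℤ² be a finite set of odd cardinality that is C_π-symmetric, i.e. there exists c ∈ ℤ² such that for all v ∈ ℤ², v ∈ V if and only if c − v ∈ V. Then there exist arbitrarily large minority domains that are never corrected: for every n ∈ ℕ there exists a configuration s with finite damage satisfying |dam(s)| ≥ n such that for every t ∈ ℕ, A_V^t(s) is not the all-false configuration. -/
/-- A finite set of odd cardinality stable under the point reflection `v ↦ c - v` contains a fixed
point of that reflection. -/
theorem exists_center_of_odd_card {G : Type*} [AddCommGroup G] {V : Finset G} (hodd : Odd V.card)
    {c : G} (hc : ∀ v, v ∈ V ↔ c - v ∈ V) : ∃ m ∈ V, c - m = m := by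
  by_contra! h
  have hsum : ∑ v ∈ V, (1 : ZMod 2) = 0 :=
    Finset.sum_involution (fun v _ => c - v) (fun _ _ => by decide) (fun v hv _ => h v hv)
      (fun v hv => (hc v).1 hv) (fun v _ => sub_sub_cancel c v)
  rw [Finset.sum_const, nsmul_one, ZMod.natCast_eq_zero_iff_even] at hsum
  exact Nat.not_even_iff_odd.2 hodd hsum

/-- If a reflection-stable set of odd cardinality meets `p` in at least one point of each reflected
pair, then `p` holds on a strict majority of it. -/
theorem card_lt_two_mul_card_filter {G : Type*} [AddCommGroup G] [DecidableEq G] {V : Finset G}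
    (hodd : Odd V.card) {c : G} {p : G → Prop} [DecidablePred p]
    (hc : ∀ v, v ∈ V ↔ c - v ∈ V) (hp : ∀ v ∈ V, p v ∨ p (c - v)) :
    V.card < 2 * (V.filter p).card := by
  have hcover : V ⊆ V.filter p ∪ (V.filter p).image (c - ·) := by
    intro v hv
    rcases hp v hv with h | h
    · exact Finset.mem_union_left _ (Finset.mem_filter.2 ⟨hv, h⟩)
    · exact Finset.mem_union_right _ (Finset.mem_image.2
        ⟨c - v, Finset.mem_filter.2 ⟨(hc v).1 hv, h⟩, sub_sub_cancel c v⟩)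
  have hle := (Finset.card_le_card hcover).trans (Finset.card_union_le _ _)
  have himage := Finset.card_image_le (s := V.filter p) (f := (c - ·))
  obtain ⟨k, hk⟩ := hodd
  omega

/-- The Minkowski sum of `T` and the set of subset sums of the translate `V - m`. -/
def subsetSumDomain {G : Type*} [AddCommGroup G] [DecidableEq G] (V : Finset G) (m : G)
    (T : Finset G) : Finset G :=
  (T ×ˢ V.powerset).image fun q => q.1 + ∑ v ∈ q.2, (v - m)

theorem mem_subsetSumDomain {G : Type*} [AddCommGroup G] [DecidableEq G] {V T : Finset G}
    {m r : G} :
    r ∈ subsetSumDomain V m T ↔ ∃ x ∈ T, ∃ X ⊆ V, x + ∑ v ∈ X, (v - m) = r := by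
  simp [subsetSumDomain, and_assoc]

theorem subset_subsetSumDomain {G : Type*} [AddCommGroup G] [DecidableEq G] (V : Finset G) (m : G)
    (T : Finset G) : T ⊆ subsetSumDomain V m T := fun x hx =>
  mem_subsetSumDomain.2 ⟨x, hx, ∅, Finset.empty_subset V, by simp⟩

theorem add_mem_or_sub_mem_subsetSumDomain {G : Type*} [AddCommGroup G] [DecidableEq G]
    {V T : Finset G} {m r v : G} (hr : r ∈ subsetSumDomain V m T) (hv : v ∈ V) :
    r + (v - m) ∈ subsetSumDomain V m T ∨ r - (v - m) ∈ subsetSumDomain V m T := by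
  obtain ⟨x, hx, X, hX, rfl⟩ := mem_subsetSumDomain.1 hr
  by_cases hvX : v ∈ X
  · refine .inr (mem_subsetSumDomain.2 ⟨x, hx, X.erase v, (X.erase_subset v).trans hX, ?_⟩)
    rw [← Finset.add_sum_erase X _ hvX]
    abel
  · refine .inl (mem_subsetSumDomain.2 ⟨x, hx, insert v X, Finset.insert_subset hv hX, ?_⟩)
    rw [Finset.sum_insert hvX]
    abel

/-- A domain containing, with each of its points `r` and each `v ∈ V`, one of `r ± (v - m)`
persists under `majCA V`, drifting by `-m` at each step. -/
theorem iterate_majCA_eq_true {V : Finset (ℤ × ℤ)} (hodd : Odd V.card) {m : ℤ × ℤ}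
    (hm : ∀ v, v ∈ V ↔ m + m - v ∈ V) {D : Set (ℤ × ℤ)}
    (hD : ∀ r ∈ D, ∀ v ∈ V, r + (v - m) ∈ D ∨ r - (v - m) ∈ D) {s : Config}
    (hs : ∀ r ∈ D, s r = true) (t : ℕ) :
    ∀ r ∈ D, (majCA V)^[t] s (r - t • m) = true := by
  induction t with
  | zero => simpa using hs
  | succ t ih =>
    intro r hr
    rw [Function.iterate_succ_apply', majCA, decide_eq_true_iff]
    refine card_lt_two_mul_card_filter hodd hm fun v hv => (hD r hr v hv).imp ?_ ?_ <;>
    · intro h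
      convert ih _ h using 2
      rw [succ_nsmul]
      abel

theorem arbitrarily_large_uncorrected_domains
    (V : Finset (ℤ × ℤ)) (hodd : Odd V.card) (hsym : CpiSymmetric V) :
    ∀ n : ℕ, ∃ s : Config,
      {r : ℤ × ℤ | s r = true}.Finite ∧
      n ≤ {r : ℤ × ℤ | s r = true}.ncard ∧
      ∀ t : ℕ, (majCA V)^[t] s ≠ allFalse := by
  obtain ⟨c, hc⟩ := hsym
  obtain ⟨m, -, hcm⟩ := exists_center_of_odd_card hodd hc
  obtain rfl : c = m + m := sub_eq_iff_eq_add.1 hcm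
  intro n
  obtain ⟨T, hT⟩ := Infinite.exists_subset_card_eq (ℤ × ℤ) (n + 1)
  set D := subsetSumDomain V m T
  have hTD : T ⊆ D := subset_subsetSumDomain V m T
  have hset : {r : ℤ × ℤ | decide (r ∈ D) = true} = D := by ext; simp
  refine ⟨fun r => decide (r ∈ D), ?_, ?_, fun t h => ?_⟩
  · rw [hset]
    exact D.finite_toSet
  · rw [hset, Set.ncard_coe_finset]
    have := Finset.card_le_card hTD
    omega
  · obtain ⟨x, hx⟩ : T.Nonempty := Finset.card_pos.1 (by omega)
    have htrue := iterate_majCA_eq_true hodd hc (D := D) (s := fun r => decide (r ∈ D))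
      (fun r hr v hv => add_mem_or_sub_mem_subsetSumDomain hr hv) (by simp) t x (hTD hx)
    rw [h] at htrue
    exact Bool.false_ne_true htrue
end

section
/- Let V = {(0,0), (1,−1), (−1,−1), (2,2), (−2,2)} ⊆ ℤ². Then: (i) V is not C_π-symmetric, i.e. there is no c ∈ ℤ² such that for all v ∈ ℤ², v ∈ V if and only if c − v ∈ V; and yet (ii) the majority cellular automaton A_V is not an eroder: for the configuration s whose damage is the 11 × 11 square {0,1,…,10}², A_V^t(s) is not the all-false configuration for any t ∈ ℕ. Hence the eroder criterion for asymmetric majority rules fails for voting neighborhoods of radius 2. -/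
/-- The five-site radius-2 voting neighborhood from the paper. -/
def Vexample : Finset (ℤ × ℤ) :=
  {(0, 0), (1, -1), (-1, -1), (2, 2), (-2, 2)}

/-- The configuration whose damage is the square `{0,…,10}²`. -/
def squareConfig : Config :=
  fun r => decide (0 ≤ r.1 ∧ r.1 ≤ 10 ∧ 0 ≤ r.2 ∧ r.2 ≤ 10)

/-- The majority cellular automaton is monotone in the damage. -/
theorem majCA_mono (V : Finset (ℤ × ℤ)) {s s' : Config} (h : ∀ r, s r = true → s' r = true)
    (r : ℤ × ℤ) (hr : majCA V s r = true) : majCA V s' r = true := by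
  simp only [majCA, decide_eq_true_eq] at hr ⊢
  have hle := Finset.card_le_card
    (Finset.monotone_filter_right V fun δ _ hδ => h (r + δ) hδ)
  omega

/-- The configuration whose damage is the square `{0,…,10}²` with its four corners cut off. -/
def octagonConfig : Config :=
  fun r => decide (0 ≤ r.1 ∧ r.1 ≤ 10 ∧ 0 ≤ r.2 ∧ r.2 ≤ 10 ∧
    2 ≤ r.1 + r.2 ∧ r.1 + r.2 ≤ 18 ∧ r.1 - r.2 ≤ 8 ∧ r.2 - r.1 ≤ 8)

theorem octagonConfig_le_majCA (r : ℤ × ℤ) (hr : octagonConfig r = true) :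
    majCA Vexample octagonConfig r = true := by
  have key : ∀ x ∈ Finset.Icc (0 : ℤ) 10, ∀ y ∈ Finset.Icc (0 : ℤ) 10,
      octagonConfig (x, y) = true → majCA Vexample octagonConfig (x, y) = true := by
    decide +kernel
  have h := hr
  simp only [octagonConfig, decide_eq_true_eq] at h
  exact key r.1 (Finset.mem_Icc.2 ⟨h.1, h.2.1⟩) r.2 (Finset.mem_Icc.2 ⟨h.2.2.1, h.2.2.2.1⟩) hr

theorem octagonConfig_le_iterate (t : ℕ) (r : ℤ × ℤ) (hr : octagonConfig r = true) :
    (majCA Vexample)^[t] squareConfig r = true := by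
  induction t generalizing r with
  | zero =>
    simp only [octagonConfig, decide_eq_true_eq] at hr
    simp only [Function.iterate_zero, id, squareConfig, decide_eq_true_eq]
    omega
  | succ t ih =>
    rw [Function.iterate_succ_apply']
    exact majCA_mono Vexample ih r (octagonConfig_le_majCA r hr)

theorem not_CpiSymmetric_Vexample : ¬ CpiSymmetric Vexample := by
  rintro ⟨⟨a, b⟩, h⟩
  have h₁ := (h (0, 0)).1 (by decide)
  have h₂ := (h (1, -1)).1 (by decide)
  have h₃ := (h (2, 2)).1 (by decide)
  simp only [Vexample, Prod.mk_sub_mk, Finset.mem_insert, Finset.mem_singleton,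
    Prod.mk.injEq] at h₁ h₂ h₃
  omega

theorem radius_two_asymmetric_non_eroder :
    ¬ CpiSymmetric Vexample ∧
    ∀ t : ℕ, (majCA Vexample)^[t] squareConfig ≠ allFalse := by
  refine ⟨not_CpiSymmetric_Vexample, fun t ht => ?_⟩
  have h := octagonConfig_le_iterate t (5, 5) (by decide)
  simp [ht, allFalse] at h
end
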